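/- (Global linear convergence of the natural policy gradient method.) Let K⁰ ∈ 𝕂. For any step size 0 < η ≤ (1/2)·(‖R‖_max + ‖B‖²_max·C(K⁰)/μ)^{−1}, the iterates defined by K^{n+1} = K^n − 2ηL^{K^n} satisfy K^n ∈ 𝕂 for every n ≥ 0 and C(K^n) − C(K*) ≤ (1 − 2μΛ_min(R)η/‖𝐗^{K*}‖_max)^n · (C(K⁰) − C(K*)). -/

import Mathlib

open Matrix Filter
open scoped Kronecker Topology

namespace MJLS

noncomputable section

attribute [local instance] Classical.propDecidable

/-- Closed-loop matrices `Γ i = A i - B i * K i`. -/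
def Gam {d k N : ℕ} (A : Fin N → Matrix (Fin d) (Fin d) ℝ)
    (B : Fin N → Matrix (Fin d) (Fin k) ℝ)
    (K : Fin N → Matrix (Fin k) (Fin d) ℝ) : Fin N → Matrix (Fin d) (Fin d) ℝ :=
  fun i => A i - B i * K i

/-- The operator `E_i(V) = ∑ j, p i j • V j`. -/
def opE {d N : ℕ} (Pr : Matrix (Fin N) (Fin N) ℝ)
    (V : Fin N → Matrix (Fin d) (Fin d) ℝ) : Fin N → Matrix (Fin d) (Fin d) ℝ :=
  fun i => ∑ j, Pr i j • V j

/-- The matrix `𝒜 = diag(Γᵀ ⊗ Γᵀ) (P ⊗ I)`. -/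
def calA {d N : ℕ} (Pr : Matrix (Fin N) (Fin N) ℝ)
    (Γ : Fin N → Matrix (Fin d) (Fin d) ℝ) :
    Matrix (Fin N × Fin d × Fin d) (Fin N × Fin d × Fin d) ℝ :=
  (Matrix.reindex (Equiv.prodComm (Fin d × Fin d) (Fin N))
      (Equiv.prodComm (Fin d × Fin d) (Fin N))
      (Matrix.blockDiagonal fun i => (Γ i)ᵀ ⊗ₖ (Γ i)ᵀ)) *
    (Pr ⊗ₖ (1 : Matrix (Fin d × Fin d) (Fin d × Fin d) ℝ))

/-- `K` is mean-square stabilizing: the spectral radius of `𝒜` is less than `1`. -/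
def MSS {d k N : ℕ} (Pr : Matrix (Fin N) (Fin N) ℝ)
    (A : Fin N → Matrix (Fin d) (Fin d) ℝ) (B : Fin N → Matrix (Fin d) (Fin k) ℝ)
    (K : Fin N → Matrix (Fin k) (Fin d) ℝ) : Prop :=
  spectralRadius ℂ ((calA Pr (Gam A B K)).map (algebraMap ℝ ℂ)) < 1

/-- `P` solves the coupled Lyapunov equations for the policy `K`. -/
def IsLyap {d k N : ℕ} (Pr : Matrix (Fin N) (Fin N) ℝ)
    (A : Fin N → Matrix (Fin d) (Fin d) ℝ) (B : Fin N → Matrix (Fin d) (Fin k) ℝ)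
    (Q : Fin N → Matrix (Fin d) (Fin d) ℝ) (R : Fin N → Matrix (Fin k) (Fin k) ℝ)
    (K : Fin N → Matrix (Fin k) (Fin d) ℝ)
    (P : Fin N → Matrix (Fin d) (Fin d) ℝ) : Prop :=
  ∀ i, P i = Q i + (K i)ᵀ * R i * K i + (Gam A B K i)ᵀ * opE Pr P i * Gam A B K i

/-- `P^K`, the (for mean-square stabilizing `K`, unique) solution of the coupled
Lyapunov equations. -/
def PK {d k N : ℕ} (Pr : Matrix (Fin N) (Fin N) ℝ)
    (A : Fin N → Matrix (Fin d) (Fin d) ℝ) (B : Fin N → Matrix (Fin d) (Fin k) ℝ)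
    (Q : Fin N → Matrix (Fin d) (Fin d) ℝ) (R : Fin N → Matrix (Fin k) (Fin k) ℝ)
    (K : Fin N → Matrix (Fin k) (Fin d) ℝ) : Fin N → Matrix (Fin d) (Fin d) ℝ :=
  if h : ∃ P, IsLyap Pr A B Q R K P then h.choose else 0

/-- The LQR cost `C(K) = ∑ i, π i * tr(P^K_i Sg)`. -/
def cost {d k N : ℕ} (Pr : Matrix (Fin N) (Fin N) ℝ)
    (A : Fin N → Matrix (Fin d) (Fin d) ℝ) (B : Fin N → Matrix (Fin d) (Fin k) ℝ)
    (Q : Fin N → Matrix (Fin d) (Fin d) ℝ) (R : Fin N → Matrix (Fin k) (Fin k) ℝ)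
    (piv : Fin N → ℝ) (Sg : Matrix (Fin d) (Fin d) ℝ)
    (K : Fin N → Matrix (Fin k) (Fin d) ℝ) : ℝ :=
  ∑ i, piv i * (PK Pr A B Q R K i * Sg).trace

/-- The operator `T_j(V) = ∑ i, p i j • (Γ i * V i * Γ iᵀ)`. -/
def opT {d N : ℕ} (Pr : Matrix (Fin N) (Fin N) ℝ)
    (Γ : Fin N → Matrix (Fin d) (Fin d) ℝ)
    (V : Fin N → Matrix (Fin d) (Fin d) ℝ) : Fin N → Matrix (Fin d) (Fin d) ℝ :=
  fun j => ∑ i, Pr i j • (Γ i * V i * (Γ i)ᵀ)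

/-- `𝐗^K = ∑_{t=0}^∞ T^t(X(0))` with `X_i(0) = π i • Sg`. -/
def XK {d N : ℕ} (Pr : Matrix (Fin N) (Fin N) ℝ) (piv : Fin N → ℝ)
    (Sg : Matrix (Fin d) (Fin d) ℝ) (Γ : Fin N → Matrix (Fin d) (Fin d) ℝ) :
    Fin N → Matrix (Fin d) (Fin d) ℝ :=
  ∑' t : ℕ, (opT Pr Γ)^[t] (fun i => piv i • Sg)

/-- `L^K_i = (R i + B iᵀ E_i(P^K) B i) K i - B iᵀ E_i(P^K) A i`. -/
def LK {d k N : ℕ} (Pr : Matrix (Fin N) (Fin N) ℝ)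
    (A : Fin N → Matrix (Fin d) (Fin d) ℝ) (B : Fin N → Matrix (Fin d) (Fin k) ℝ)
    (Q : Fin N → Matrix (Fin d) (Fin d) ℝ) (R : Fin N → Matrix (Fin k) (Fin k) ℝ)
    (K : Fin N → Matrix (Fin k) (Fin d) ℝ) : Fin N → Matrix (Fin k) (Fin d) ℝ :=
  fun i => (R i + (B i)ᵀ * opE Pr (PK Pr A B Q R K) i * B i) * K i
    - (B i)ᵀ * opE Pr (PK Pr A B Q R K) i * A i

/-- The operator `L_i(V) = Γ iᵀ E_i(V) Γ i`. -/
def opL {d N : ℕ} (Pr : Matrix (Fin N) (Fin N) ℝ)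
    (Γ : Fin N → Matrix (Fin d) (Fin d) ℝ)
    (V : Fin N → Matrix (Fin d) (Fin d) ℝ) : Fin N → Matrix (Fin d) (Fin d) ℝ :=
  fun i => (Γ i)ᵀ * opE Pr V i * Γ i

/-- `(P^K)'[E] = ∑_{t=0}^∞ L^t(Eᵀ L^K + (L^K)ᵀ E)`. -/
def PKd {d k N : ℕ} (Pr : Matrix (Fin N) (Fin N) ℝ)
    (Γ : Fin N → Matrix (Fin d) (Fin d) ℝ)
    (Lk E : Fin N → Matrix (Fin k) (Fin d) ℝ) : Fin N → Matrix (Fin d) (Fin d) ℝ :=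
  ∑' t : ℕ, (opL Pr Γ)^[t] (fun i => (E i)ᵀ * Lk i + (Lk i)ᵀ * E i)

/-- `‖V‖₂² = ∑ i, tr(V iᵀ V i)`. -/
def norm2sq {a b N : ℕ} (V : Fin N → Matrix (Fin a) (Fin b) ℝ) : ℝ :=
  ∑ i, ((V i)ᵀ * V i).trace

/-- The inner product `⟨V, S⟩ = ∑ i, tr(V iᵀ S i)`. -/
def ip {a b N : ℕ} (V S : Fin N → Matrix (Fin a) (Fin b) ℝ) : ℝ :=
  ∑ i, ((V i)ᵀ * S i).trace

/-- The spectral norm (maximal singular value) of a matrix. -/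
def specNorm {a b : ℕ} (M : Matrix (Fin a) (Fin b) ℝ) : ℝ :=
  ⨆ x : {x : EuclideanSpace ℝ (Fin b) // ‖x‖ ≤ 1}, ‖Matrix.toEuclideanLin M x.1‖

/-- The minimal singular value of a square matrix. -/
def sigmaMin {a : ℕ} (M : Matrix (Fin a) (Fin a) ℝ) : ℝ :=
  ⨅ x : {x : EuclideanSpace ℝ (Fin a) // ‖x‖ = 1}, ‖Matrix.toEuclideanLin M x.1‖

/-- `‖V‖_max = max_i ‖V i‖` (spectral norms). -/
def maxNorm {a b N : ℕ} (V : Fin N → Matrix (Fin a) (Fin b) ℝ) : ℝ :=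
  ⨆ i, specNorm (V i)

/-- `Λ_min(V) = min_i σ_min(V i)`. -/
def lamMin {a N : ℕ} (V : Fin N → Matrix (Fin a) (Fin a) ℝ) : ℝ :=
  ⨅ i, sigmaMin (V i)

/-- `μ = (min_i π i) · σ_min(Sg)`. -/
def mu {d N : ℕ} (piv : Fin N → ℝ) (Sg : Matrix (Fin d) (Fin d) ℝ) : ℝ :=
  (⨅ i, piv i) * sigmaMin Sg

/-- `ξ(α) = (1/Λ_min(Q))·((1 + ‖B‖²_max)·α/μ + ‖R‖_max) − 1`. -/
def xi {d k N : ℕ} (B : Fin N → Matrix (Fin d) (Fin k) ℝ)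
    (R : Fin N → Matrix (Fin k) (Fin k) ℝ) (Q : Fin N → Matrix (Fin d) (Fin d) ℝ)
    (piv : Fin N → ℝ) (Sg : Matrix (Fin d) (Fin d) ℝ) (α : ℝ) : ℝ :=
  (1 / lamMin Q) * ((1 + maxNorm B ^ 2) * α / mu piv Sg + maxNorm R) - 1

/-- The smoothness constant
`L(α) = 2·(‖R‖_max + ‖B‖²_max·(1 + 2ξ(α)/‖B‖_max)·α/μ)·α/Λ_min(Q)`. -/
def Lsm {d k N : ℕ} (B : Fin N → Matrix (Fin d) (Fin k) ℝ)
    (R : Fin N → Matrix (Fin k) (Fin k) ℝ) (Q : Fin N → Matrix (Fin d) (Fin d) ℝ)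
    (piv : Fin N → ℝ) (Sg : Matrix (Fin d) (Fin d) ℝ) (α : ℝ) : ℝ :=
  2 * (maxNorm R + maxNorm B ^ 2 * (1 + 2 * xi B R Q piv Sg α / maxNorm B)
      * α / mu piv Sg) * α / lamMin Q

end


section SpecRad

attribute [local instance] Matrix.linftyOpNormedRing Matrix.linftyOpNormedAlgebra
  Matrix.linftyOpNormedAddCommGroup

lemma entry_le_norm {n : Type*} [Fintype n] [DecidableEq n] (M : Matrix n n ℂ) (a b : n) :
    ‖M a b‖ ≤ ‖M‖ := by
  have h : ‖M a b‖₊ ≤ ‖M‖₊ := by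
    rw [Matrix.linfty_opNNNorm_def]
    calc ‖M a b‖₊ ≤ ∑ j, ‖M a j‖₊ :=
          Finset.single_le_sum (f := fun j => ‖M a j‖₊) (fun _ _ => zero_le) (Finset.mem_univ b)
      _ ≤ _ := Finset.le_sup (f := fun i => ∑ j, ‖M i j‖₊) (Finset.mem_univ a)
  exact_mod_cast h

lemma map_pow_entry {n : Type*} [Fintype n] [DecidableEq n] (M : Matrix n n ℝ) (t : ℕ) :
    (M.map (algebraMap ℝ ℂ)) ^ t = (M ^ t).map (algebraMap ℝ ℂ) := by
  have := map_pow ((algebraMap ℝ ℂ).mapMatrix (m := n)) M t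
  simpa using this.symm

lemma summable_of_specRad {n : Type*} [Fintype n] [DecidableEq n] (M : Matrix n n ℝ)
    (h : spectralRadius ℂ (M.map (algebraMap ℝ ℂ)) < 1) (a b : n) :
    Summable (fun t : ℕ => (M ^ t) a b) := by
  have : CompleteSpace (Matrix n n ℂ) := FiniteDimensional.complete ℂ _
  obtain ⟨r, hr1, hr2⟩ := ENNReal.lt_iff_exists_nnreal_btwn.mp h
  have hr2' : r < 1 := by exact_mod_cast hr2
  have hG := spectrum.pow_nnnorm_pow_one_div_tendsto_nhds_spectralRadius
    (M.map (algebraMap ℝ ℂ))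
  have hev := hG.eventually (gt_mem_nhds hr1)
  refine Summable.of_norm_bounded_eventually_nat (g := fun t => (r : ℝ) ^ t)
    (summable_geometric_of_lt_one r.2 (by exact_mod_cast hr2')) ?_
  filter_upwards [hev, eventually_gt_atTop 0] with t ht ht0
  have h1 : (‖(M.map (algebraMap ℝ ℂ)) ^ t‖₊ : ENNReal) ≤ (r : ENNReal) ^ t := by
    have h2 := ENNReal.rpow_le_rpow ht.le (z := (t : ℝ)) (by positivity)
    rw [← ENNReal.rpow_mul, one_div, inv_mul_cancel₀ (by positivity), ENNReal.rpow_one,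
      ENNReal.rpow_natCast] at h2
    exact h2
  have h3 : ‖(M.map (algebraMap ℝ ℂ)) ^ t‖ ≤ (r : ℝ) ^ t := by exact_mod_cast h1
  have h4 := (entry_le_norm _ a b).trans h3
  rw [map_pow_entry] at h4
  simpa using h4

lemma specRad_lt_one {n : Type*} [Fintype n] [DecidableEq n] [Nonempty n] (M : Matrix n n ℝ)
    (h : ∀ a b, Tendsto (fun t : ℕ => (M ^ t) a b) atTop (𝓝 0)) :
    spectralRadius ℂ (M.map (algebraMap ℝ ℂ)) < 1 := by
  have : CompleteSpace (Matrix n n ℂ) := FiniteDimensional.complete ℂ _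
  have ht : Tendsto (fun t : ℕ => ∑ a, ∑ b, ‖(M ^ t) a b‖) atTop (𝓝 0) := by
    have : Tendsto (fun t : ℕ => ∑ a, ∑ b, ‖(M ^ t) a b‖) atTop
        (𝓝 (∑ a : n, ∑ b : n, (0:ℝ))) :=
      tendsto_finsetSum _ fun a _ => tendsto_finsetSum _ fun b _ => by
        simpa using (h a b).norm
    simpa using this
  obtain ⟨t, ht1, ht0⟩ := ((ht.eventually (gt_mem_nhds one_pos)).and
    (eventually_gt_atTop 0)).exists
  have hn : ‖(M.map (algebraMap ℝ ℂ)) ^ t‖₊ < 1 := by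
    rw [map_pow_entry, Matrix.linfty_opNNNorm_def, Finset.sup_lt_iff (by simp)]
    intro a _
    have : ∑ j, ‖(M ^ t) a j‖ ≤ ∑ a, ∑ b, ‖(M ^ t) a b‖ :=
      Finset.single_le_sum (f := fun a => ∑ b, ‖(M ^ t) a b‖)
        (fun _ _ => Finset.sum_nonneg fun _ _ => norm_nonneg _) (Finset.mem_univ a)
    have h2 := this.trans_lt ht1
    rw [← NNReal.coe_lt_coe]
    push_cast
    simpa using h2
  have hle := (spectrum.spectralRadius_pow_le (𝕜 := ℂ) (M.map (algebraMap ℝ ℂ)) t ht0.ne').trans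
    (spectrum.spectralRadius_le_nnnorm (𝕜 := ℂ) ((M.map (algebraMap ℝ ℂ)) ^ t))
  by_contra hc
  push Not at hc
  have h5 : (1 : ENNReal) ≤ spectralRadius ℂ (M.map (algebraMap ℝ ℂ)) ^ t := one_le_pow₀ hc
  have h6 := h5.trans hle
  have h7 : (1 : NNReal) ≤ ‖(M.map (algebraMap ℝ ℂ)) ^ t‖₊ := by exact_mod_cast h6
  exact absurd hn (not_lt.mpr h7)

end SpecRad

section Ops

variable {d k N : ℕ}

lemma calA_mulVec (Pr : Matrix (Fin N) (Fin N) ℝ) (Γ V : Fin N → Matrix (Fin d) (Fin d) ℝ) :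
    calA Pr Γ *ᵥ (fun q => V q.1 q.2.1 q.2.2) = fun q => opL Pr Γ V q.1 q.2.1 q.2.2 := by
  unfold calA
  rw [← Matrix.mulVec_mulVec]
  have h1 : (Pr ⊗ₖ (1 : Matrix (Fin d × Fin d) (Fin d × Fin d) ℝ)) *ᵥ
      (fun q => V q.1 q.2.1 q.2.2) = fun q => opE Pr V q.1 q.2.1 q.2.2 := by
    ext ⟨i, a, b⟩
    simp [Matrix.mulVec, dotProduct, Fintype.sum_prod_type, Matrix.kroneckerMap_apply,
      Matrix.one_apply, opE, Matrix.sum_apply, ite_and, Prod.ext_iff]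
  convert congrArg _ h1 using 1
  ext ⟨i, a, b⟩
  simp [Matrix.mulVec, dotProduct, Fintype.sum_prod_type, Matrix.kroneckerMap_apply,
      Matrix.blockDiagonal_apply, opL, Matrix.mul_apply, Finset.sum_mul, ite_mul]
  rw [Finset.sum_comm]
  refine Finset.sum_congr rfl fun x _ => Finset.sum_congr rfl fun y _ => ?_
  ring

lemma calA_pow_mulVec [inst : DecidableEq (Fin N × Fin d × Fin d)]
    (Pr : Matrix (Fin N) (Fin N) ℝ) (Γ V : Fin N → Matrix (Fin d) (Fin d) ℝ)
    (t : ℕ) :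
    (calA Pr Γ ^ t) *ᵥ (fun q => V q.1 q.2.1 q.2.2)
      = fun q => (opL Pr Γ)^[t] V q.1 q.2.1 q.2.2 := by
  induction t with
  | zero => simp
  | succ t ih =>
    rw [pow_succ', ← Matrix.mulVec_mulVec, ih, calA_mulVec, Function.iterate_succ_apply']

lemma mss_summable {Pr : Matrix (Fin N) (Fin N) ℝ}
    {A : Fin N → Matrix (Fin d) (Fin d) ℝ} {B : Fin N → Matrix (Fin d) (Fin k) ℝ}
    {K : Fin N → Matrix (Fin k) (Fin d) ℝ} (h : MSS Pr A B K)
    (V : Fin N → Matrix (Fin d) (Fin d) ℝ) (i a b) :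
    Summable fun t : ℕ => (opL Pr (Gam A B K))^[t] V i a b := by
  unfold MSS at h
  have hs := summable_of_specRad _ h
  have : (fun t : ℕ => (opL Pr (Gam A B K))^[t] V i a b) = fun t =>
      ∑ q, (calA Pr (Gam A B K) ^ t) (i, a, b) q * V q.1 q.2.1 q.2.2 := by
    ext t
    have := congrFun (calA_pow_mulVec Pr (Gam A B K) V t) (i, a, b)
    simp only at this
    rw [← this]; rfl
  rw [this]
  exact summable_sum fun q _ => (hs _ q).mul_right _

lemma mss_of_tendsto (hd : 0 < d) (hN : 0 < N) {Pr : Matrix (Fin N) (Fin N) ℝ}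
    {A : Fin N → Matrix (Fin d) (Fin d) ℝ} {B : Fin N → Matrix (Fin d) (Fin k) ℝ}
    {K : Fin N → Matrix (Fin k) (Fin d) ℝ}
    (h : ∀ V : Fin N → Matrix (Fin d) (Fin d) ℝ, ∀ i a b,
      Tendsto (fun t : ℕ => (opL Pr (Gam A B K))^[t] V i a b) atTop (𝓝 0)) :
    MSS Pr A B K := by
  have : Nonempty (Fin N × Fin d × Fin d) := ⟨(⟨0, hN⟩, ⟨0, hd⟩, ⟨0, hd⟩)⟩
  unfold MSS
  apply specRad_lt_one
  intro q q'
  obtain ⟨i, a, b⟩ := q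
  let V : Fin N → Matrix (Fin d) (Fin d) ℝ := fun j x y => (Pi.single q' (1:ℝ) :
    Fin N × Fin d × Fin d → ℝ) (j, x, y)
  refine (h V i a b).congr fun t => ?_
  have := congrFun (calA_pow_mulVec (inst := Classical.decEq _) Pr (Gam A B K) V t) (i, a, b)
  simp only at this
  rw [← this]
  have hV : (fun q : Fin N × Fin d × Fin d => V q.1 q.2.1 q.2.2) = Pi.single q' 1 := rfl
  rw [hV, Matrix.mulVec_single_one]
  simp only [Matrix.col_apply]
  congr!

end Ops

section Norms

lemma euclid_norm_sq {n : ℕ} (x : EuclideanSpace ℝ (Fin n)) :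
    ‖x‖ ^ 2 = x.ofLp ⬝ᵥ x.ofLp := by
  rw [EuclideanSpace.real_norm_sq_eq]
  simp [dotProduct, sq]

lemma euclid_inner {n : ℕ} (x y : EuclideanSpace ℝ (Fin n)) :
    inner ℝ x y = x.ofLp ⬝ᵥ y.ofLp := by
  simp [EuclideanSpace.inner_eq_star_dotProduct, dotProduct_comm]

lemma specNorm_bdd {a b : ℕ} (M : Matrix (Fin a) (Fin b) ℝ) :
    BddAbove (Set.range fun x : {x : EuclideanSpace ℝ (Fin b) // ‖x‖ ≤ 1} =>
      ‖Matrix.toEuclideanLin M x.1‖) := by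
  refine ⟨‖(Matrix.toEuclideanLin M).toContinuousLinearMap‖, ?_⟩
  rintro _ ⟨x, rfl⟩
  exact ((Matrix.toEuclideanLin M).toContinuousLinearMap.le_opNorm x.1).trans
    (mul_le_of_le_one_right (norm_nonneg _) x.2)

lemma specNorm_nonneg {a b : ℕ} (M : Matrix (Fin a) (Fin b) ℝ) : 0 ≤ specNorm M :=
  Real.iSup_nonneg fun _ => norm_nonneg _

lemma le_specNorm {a b : ℕ} (M : Matrix (Fin a) (Fin b) ℝ) (x : EuclideanSpace ℝ (Fin b)) :
    ‖Matrix.toEuclideanLin M x‖ ≤ specNorm M * ‖x‖ := by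
  rcases eq_or_ne x 0 with rfl | hx
  · simp
  have hx' : 0 < ‖x‖ := norm_pos_iff.mpr hx
  have h := le_ciSup (specNorm_bdd M) ⟨‖x‖⁻¹ • x, by
    rw [norm_smul, norm_inv, norm_norm, inv_mul_cancel₀ hx'.ne']⟩
  simp only [map_smul, norm_smul, norm_inv, norm_norm] at h
  change _ ≤ specNorm M at h
  rwa [inv_mul_le_iff₀ hx', mul_comm] at h

lemma le_maxNorm {a b N : ℕ} (V : Fin N → Matrix (Fin a) (Fin b) ℝ) (i : Fin N) :
    specNorm (V i) ≤ maxNorm V :=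
  le_ciSup (f := fun i => specNorm (V i)) (Set.finite_range _).bddAbove i

lemma maxNorm_nonneg {a b N : ℕ} (V : Fin N → Matrix (Fin a) (Fin b) ℝ) : 0 ≤ maxNorm V :=
  Real.iSup_nonneg fun _ => specNorm_nonneg _

lemma maxNorm_mulVec {a b N : ℕ} (V : Fin N → Matrix (Fin a) (Fin b) ℝ) (i : Fin N)
    (x : Fin b → ℝ) :
    (V i *ᵥ x) ⬝ᵥ (V i *ᵥ x) ≤ maxNorm V ^ 2 * (x ⬝ᵥ x) := by
  have h := (le_specNorm (V i) (WithLp.toLp 2 x)).trans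
    (mul_le_mul_of_nonneg_right (le_maxNorm V i) (norm_nonneg _))
  have h2 := pow_le_pow_left₀ (norm_nonneg _) h 2
  rw [mul_pow, euclid_norm_sq, euclid_norm_sq] at h2
  simpa using h2

lemma abs_dot_le {n : ℕ} (x y : Fin n → ℝ) :
    |x ⬝ᵥ y| ≤ ‖WithLp.toLp 2 x‖ * ‖WithLp.toLp 2 y‖ := by
  have := abs_real_inner_le_norm (WithLp.toLp 2 x) (WithLp.toLp 2 y)
  rwa [euclid_inner] at this

lemma maxNorm_bilin {a b N : ℕ} (V : Fin N → Matrix (Fin a) (Fin b) ℝ) (i : Fin N)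
    (x : Fin a → ℝ) (y : Fin b → ℝ) :
    |x ⬝ᵥ V i *ᵥ y| ≤ maxNorm V * (‖WithLp.toLp 2 x‖ * ‖WithLp.toLp 2 y‖) := by
  have h := (le_specNorm (V i) (WithLp.toLp 2 y)).trans
    (mul_le_mul_of_nonneg_right (le_maxNorm V i) (norm_nonneg _))
  have h1 := abs_dot_le x (V i *ᵥ y)
  have h2 : ‖WithLp.toLp 2 (V i *ᵥ y)‖ ≤ maxNorm V * ‖WithLp.toLp 2 y‖ := by simpa using h
  calc _ ≤ _ := h1
    _ ≤ ‖WithLp.toLp 2 x‖ * (maxNorm V * ‖WithLp.toLp 2 y‖) := by gcongr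
    _ = _ := by ring

lemma maxNorm_quad {a N : ℕ} (V : Fin N → Matrix (Fin a) (Fin a) ℝ) (i : Fin N)
    (x : Fin a → ℝ) : x ⬝ᵥ V i *ᵥ x ≤ maxNorm V * (x ⬝ᵥ x) := by
  have h := (le_abs_self _).trans (maxNorm_bilin V i x x)
  have := euclid_norm_sq (WithLp.toLp 2 x)
  rwa [← sq, this] at h

lemma posDef_sub_psd {n : ℕ} {S : Matrix (Fin n) (Fin n) ℝ} (hS : S.IsHermitian) (c : ℝ)
    (hc : ∀ j, c ≤ hS.eigenvalues j) : (S - c • (1 : Matrix (Fin n) (Fin n) ℝ)).PosSemidef := by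
  have h := hS.spectral_theorem
  have h2 : S - c • (1 : Matrix (Fin n) (Fin n) ℝ) =
      Unitary.conjStarAlgAut ℝ _ hS.eigenvectorUnitary
        (diagonal (fun j => hS.eigenvalues j - c)) := by
    have h3 : diagonal (fun j => hS.eigenvalues j - c) =
      diagonal (RCLike.ofReal ∘ hS.eigenvalues) - c • (1 : Matrix (Fin n) (Fin n) ℝ) := by
      ext a b
      by_cases hab : a = b <;> simp [hab]
    rw [h3, map_sub, ← h, map_smul, map_one]
  rw [h2]
  simp [Unitary.isUnit_coe.posSemidef_star_right_conjugate_iff, posSemidef_diagonal_iff]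
  exact hc

lemma sigmaMin_le_eig {n : ℕ} {S : Matrix (Fin n) (Fin n) ℝ} (hS : S.PosDef) (j : Fin n) :
    sigmaMin S ≤ hS.1.eigenvalues j := by
  have hb : BddBelow (Set.range fun x : {x : EuclideanSpace ℝ (Fin n) // ‖x‖ = 1} =>
      ‖Matrix.toEuclideanLin S x.1‖) := ⟨0, by rintro _ ⟨x, rfl⟩; exact norm_nonneg _⟩
  have h := ciInf_le hb ⟨hS.1.eigenvectorBasis j, by simp⟩
  change sigmaMin S ≤ _ at h
  refine h.trans_eq ?_
  have h2 : Matrix.toEuclideanLin S (hS.1.eigenvectorBasis j)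
      = hS.1.eigenvalues j • hS.1.eigenvectorBasis j := by
    apply WithLp.ofLp_injective
    simpa using hS.1.mulVec_eigenvectorBasis j
  simp only [h2, norm_smul, OrthonormalBasis.norm_eq_one, mul_one, Real.norm_eq_abs]
  exact abs_of_nonneg (hS.posSemidef.eigenvalues_nonneg j)

lemma sigmaMin_psd {n : ℕ} {S : Matrix (Fin n) (Fin n) ℝ} (hS : S.PosDef) :
    (S - sigmaMin S • (1 : Matrix (Fin n) (Fin n) ℝ)).PosSemidef :=
  posDef_sub_psd hS.1 _ (sigmaMin_le_eig hS)

lemma psd_sub_dot {n : ℕ} {S : Matrix (Fin n) (Fin n) ℝ} {c : ℝ}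
    (h : (S - c • (1 : Matrix (Fin n) (Fin n) ℝ)).PosSemidef) (x : Fin n → ℝ) :
    c * (x ⬝ᵥ x) ≤ x ⬝ᵥ S *ᵥ x := by
  have := h.dotProduct_mulVec_nonneg x
  simp [Matrix.sub_mulVec, Matrix.smul_mulVec, dotProduct_sub] at this
  linarith

lemma sigmaMin_dot {n : ℕ} {S : Matrix (Fin n) (Fin n) ℝ} (hS : S.PosDef) (x : Fin n → ℝ) :
    sigmaMin S * (x ⬝ᵥ x) ≤ x ⬝ᵥ S *ᵥ x := psd_sub_dot (sigmaMin_psd hS) x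

lemma sigmaMin_pos {n : ℕ} (hn : 0 < n) {S : Matrix (Fin n) (Fin n) ℝ} (hS : S.PosDef) :
    0 < sigmaMin S := by
  have : Nonempty (Fin n) := ⟨⟨0, hn⟩⟩
  obtain ⟨j, hj⟩ := Finite.exists_min hS.1.eigenvalues
  have hpos : 0 < hS.1.eigenvalues j := hS.eigenvalues_pos j
  have hq := psd_sub_dot (posDef_sub_psd hS.1 _ hj)
  have : Nonempty {x : EuclideanSpace ℝ (Fin n) // ‖x‖ = 1} :=
    ⟨⟨hS.1.eigenvectorBasis j, by simp⟩⟩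
  refine hpos.trans_le (le_ciInf fun x => ?_)
  have h1 := hq x.1.ofLp
  rw [← euclid_norm_sq, x.2] at h1
  have h2 := (le_abs_self _).trans (abs_dot_le x.1.ofLp (S *ᵥ x.1.ofLp))
  simp only [WithLp.toLp_ofLp, x.2, one_mul] at h2
  simp only [Matrix.toLpLin_apply]
  linarith

lemma lamMin_pos {n N : ℕ} (hn : 0 < n) (hN : 0 < N) {V : Fin N → Matrix (Fin n) (Fin n) ℝ}
    (hV : ∀ i, (V i).PosDef) : 0 < lamMin V := by
  have : Nonempty (Fin N) := ⟨⟨0, hN⟩⟩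
  obtain ⟨j, hj⟩ := Finite.exists_min fun i => sigmaMin (V i)
  exact (sigmaMin_pos hn (hV j)).trans_le (le_ciInf hj)

lemma lamMin_dot {n N : ℕ} {V : Fin N → Matrix (Fin n) (Fin n) ℝ}
    (hV : ∀ i, (V i).PosDef) (i : Fin N) (x : Fin n → ℝ) :
    lamMin V * (x ⬝ᵥ x) ≤ x ⬝ᵥ V i *ᵥ x := by
  refine le_trans ?_ (sigmaMin_dot (hV i) x)
  refine mul_le_mul_of_nonneg_right ?_ (by simpa using dotProduct_star_self_nonneg x)
  exact ciInf_le (f := fun i => sigmaMin (V i)) (Set.finite_range _).bddBelow i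

lemma dot_self_nonneg {n : ℕ} (x : Fin n → ℝ) : 0 ≤ x ⬝ᵥ x := by
  simpa using dotProduct_star_self_nonneg x

open scoped MatrixOrder in
lemma trace_mul_nonneg {n : ℕ} {V W : Matrix (Fin n) (Fin n) ℝ}
    (hV : ∀ x, 0 ≤ x ⬝ᵥ V *ᵥ x) (hW : W.PosSemidef) : 0 ≤ (V * W).trace := by
  obtain ⟨C, rfl⟩ := CStarAlgebra.nonneg_iff_eq_star_mul_self.mp hW.nonneg
  rw [← Matrix.mul_assoc, Matrix.trace_mul_comm, star_eq_conjTranspose]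
  refine Finset.sum_nonneg fun i _ => ?_
  have := hV (C i)
  rw [Matrix.diag_apply, Matrix.mul_apply]
  simp only [dotProduct, Matrix.mul_apply, Matrix.mulVec, Matrix.conjTranspose_apply,
    star_trivial] at this ⊢
  simpa [dotProduct] using this

lemma quad_le_trace {n : ℕ} {V : Matrix (Fin n) (Fin n) ℝ}
    (hV : ∀ x, 0 ≤ x ⬝ᵥ V *ᵥ x) (y : Fin n → ℝ) : y ⬝ᵥ V *ᵥ y ≤ V.trace * (y ⬝ᵥ y) := by
  have hW : ((y ⬝ᵥ y) • (1 : Matrix (Fin n) (Fin n) ℝ) - vecMulVec y y).PosSemidef := by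
    refine Matrix.PosSemidef.of_dotProduct_mulVec_nonneg ?_ fun x => ?_
    · ext a b
      simp [Matrix.vecMulVec_apply, Matrix.one_apply, eq_comm, mul_comm]
    · have h := abs_dot_le x y
      have h2 := pow_le_pow_left₀ (abs_nonneg _) h 2
      rw [sq_abs, mul_pow, euclid_norm_sq, euclid_norm_sq] at h2
      simp [Matrix.sub_mulVec, Matrix.smul_mulVec, dotProduct_sub, Matrix.vecMulVec_mulVec] at h2 ⊢
      rw [dotProduct_comm y x]
      nlinarith
  have := trace_mul_nonneg hV hW
  rw [Matrix.mul_sub, Matrix.trace_sub, Matrix.mul_smul, Matrix.mul_one, Matrix.trace_smul,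
    Matrix.mul_vecMulVec, Matrix.trace_vecMulVec, dotProduct_comm (V *ᵥ y)] at this
  simp only [smul_eq_mul] at this
  linarith

lemma trace_nonneg' {n : ℕ} {V : Matrix (Fin n) (Fin n) ℝ}
    (hV : ∀ x, 0 ≤ x ⬝ᵥ V *ᵥ x) : 0 ≤ V.trace := by
  simpa using trace_mul_nonneg hV Matrix.PosSemidef.one

lemma trace_mul_ge {n : ℕ} {V S : Matrix (Fin n) (Fin n) ℝ}
    (hV : ∀ x, 0 ≤ x ⬝ᵥ V *ᵥ x) (hS : S.PosDef) :
    sigmaMin S * V.trace ≤ (V * S).trace := by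
  have := trace_mul_nonneg hV (sigmaMin_psd hS)
  rw [Matrix.mul_sub, Matrix.trace_sub, Matrix.mul_smul, Matrix.mul_one, Matrix.trace_smul] at this
  simp only [smul_eq_mul] at this
  linarith

end Norms

section Lyap

variable {d k N : ℕ}

/-- The tuple `V` has nonnegative quadratic forms. -/
def QNN (V : Fin N → Matrix (Fin d) (Fin d) ℝ) : Prop :=
  ∀ i (x : Fin d → ℝ), 0 ≤ x ⬝ᵥ V i *ᵥ x

lemma opE_dot (Pr : Matrix (Fin N) (Fin N) ℝ) (V : Fin N → Matrix (Fin d) (Fin d) ℝ)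
    (i : Fin N) (x y : Fin d → ℝ) :
    x ⬝ᵥ opE Pr V i *ᵥ y = ∑ j, Pr i j * (x ⬝ᵥ V j *ᵥ y) := by
  simp [opE, Matrix.sum_mulVec, dotProduct_sum, Matrix.smul_mulVec]

lemma opL_dot (Pr : Matrix (Fin N) (Fin N) ℝ) (Γ V : Fin N → Matrix (Fin d) (Fin d) ℝ)
    (i : Fin N) (x y : Fin d → ℝ) :
    x ⬝ᵥ opL Pr Γ V i *ᵥ y = (Γ i *ᵥ x) ⬝ᵥ opE Pr V i *ᵥ (Γ i *ᵥ y) := by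
  simp only [opL, ← Matrix.mulVec_mulVec]
  rw [Matrix.dotProduct_mulVec, Matrix.vecMul_transpose]

lemma opE_qnn {Pr : Matrix (Fin N) (Fin N) ℝ} (hPr : ∀ i j, 0 ≤ Pr i j)
    {V : Fin N → Matrix (Fin d) (Fin d) ℝ} (hV : QNN V) : QNN (opE Pr V) := by
  intro i x
  rw [opE_dot]
  exact Finset.sum_nonneg fun j _ => mul_nonneg (hPr i j) (hV j x)

lemma opL_qnn {Pr : Matrix (Fin N) (Fin N) ℝ} (hPr : ∀ i j, 0 ≤ Pr i j)
    (Γ : Fin N → Matrix (Fin d) (Fin d) ℝ)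
    {V : Fin N → Matrix (Fin d) (Fin d) ℝ} (hV : QNN V) : QNN (opL Pr Γ V) := by
  intro i x
  rw [opL_dot]
  exact opE_qnn hPr hV i _

lemma opL_add (Pr : Matrix (Fin N) (Fin N) ℝ) (Γ V W : Fin N → Matrix (Fin d) (Fin d) ℝ) :
    opL Pr Γ (V + W) = opL Pr Γ V + opL Pr Γ W := by
  ext1 i
  simp [opL, opE, Finset.sum_add_distrib, Matrix.mul_add, Matrix.add_mul]

lemma opL_smul (Pr : Matrix (Fin N) (Fin N) ℝ) (Γ : Fin N → Matrix (Fin d) (Fin d) ℝ) (c : ℝ)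
    (V : Fin N → Matrix (Fin d) (Fin d) ℝ) :
    opL Pr Γ (c • V) = c • opL Pr Γ V := by
  ext1 i
  have : opE Pr (c • V) i = c • opE Pr V i := by
    simp [opE, Finset.smul_sum, smul_comm c]
  simp [opL, this]

/-- `opL` as a linear map. -/
def Llin (Pr : Matrix (Fin N) (Fin N) ℝ) (Γ : Fin N → Matrix (Fin d) (Fin d) ℝ) :
    (Fin N → Matrix (Fin d) (Fin d) ℝ) →ₗ[ℝ] (Fin N → Matrix (Fin d) (Fin d) ℝ) where
  toFun := opL Pr Γ
  map_add' := opL_add Pr Γ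
  map_smul' := opL_smul Pr Γ

lemma opL_sub (Pr : Matrix (Fin N) (Fin N) ℝ) (Γ V W : Fin N → Matrix (Fin d) (Fin d) ℝ) :
    opL Pr Γ (V - W) = opL Pr Γ V - opL Pr Γ W := map_sub (Llin Pr Γ) V W

variable {Pr : Matrix (Fin N) (Fin N) ℝ}
    {A : Fin N → Matrix (Fin d) (Fin d) ℝ} {B : Fin N → Matrix (Fin d) (Fin k) ℝ}
    {K : Fin N → Matrix (Fin k) (Fin d) ℝ}

lemma mss_tendsto_quad (h : MSS Pr A B K) (V : Fin N → Matrix (Fin d) (Fin d) ℝ) (i : Fin N)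
    (x : Fin d → ℝ) :
    Tendsto (fun t : ℕ => x ⬝ᵥ (opL Pr (Gam A B K))^[t] V i *ᵥ x) atTop (𝓝 0) := by
  have : Tendsto (fun t : ℕ => ∑ a, x a * ∑ b, (opL Pr (Gam A B K))^[t] V i a b * x b) atTop
      (𝓝 (∑ a, x a * ∑ b, 0 * x b)) :=
    tendsto_finsetSum _ fun a _ => tendsto_const_nhds.mul <| tendsto_finsetSum _ fun b _ =>
      ((mss_summable h V i a b).tendsto_atTop_zero).mul_const _
  simpa [dotProduct, Matrix.mulVec] using this

/-- Comparison principle. -/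
lemma qnn_of_lyap (hPr : ∀ i j, 0 ≤ Pr i j) (h : MSS Pr A B K)
    {V : Fin N → Matrix (Fin d) (Fin d) ℝ} (hV : QNN (V - opL Pr (Gam A B K) V)) : QNN V := by
  have key : ∀ t : ℕ, QNN (V - (opL Pr (Gam A B K))^[t] V) := by
    intro t
    induction t with
    | zero => intro i x; simp
    | succ t ih =>
      have h2 := opL_qnn hPr (Gam A B K) ih
      intro i x
      have e : V - (opL Pr (Gam A B K))^[t+1] V = (V - opL Pr (Gam A B K) V)
          + opL Pr (Gam A B K) (V - (opL Pr (Gam A B K))^[t] V) := by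
        rw [opL_sub, Function.iterate_succ_apply']; abel
      rw [e, Pi.add_apply, Matrix.add_mulVec, dotProduct_add]
      exact add_nonneg (hV i x) (h2 i x)
  intro i x
  refine le_of_tendsto' (mss_tendsto_quad h V i x) ?_
  intro t
  have := key t i x
  rw [Pi.sub_apply, Matrix.sub_mulVec, dotProduct_sub] at this
  linarith

lemma lyap_unique (h : MSS Pr A B K) {V : Fin N → Matrix (Fin d) (Fin d) ℝ}
    (hV : opL Pr (Gam A B K) V = V) : V = 0 := by
  have hit : ∀ t : ℕ, (opL Pr (Gam A B K))^[t] V = V := fun t => Function.iterate_fixed hV t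
  ext i a b
  have := (mss_summable h V i a b).tendsto_atTop_zero
  simp only [hit] at this
  exact tendsto_nhds_unique tendsto_const_nhds this

lemma lyap_exists (h : MSS Pr A B K) (M : Fin N → Matrix (Fin d) (Fin d) ℝ) :
    ∃ V, V = M + opL Pr (Gam A B K) V := by
  have hinj : Function.Injective ((LinearMap.id : (Fin N → Matrix (Fin d) (Fin d) ℝ) →ₗ[ℝ]
      (Fin N → Matrix (Fin d) (Fin d) ℝ)) - Llin Pr (Gam A B K)) := by
    rw [injective_iff_map_eq_zero]
    intro V hV
    apply lyap_unique h
    exact (sub_eq_zero.mp hV).symm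
  obtain ⟨V, hV⟩ := (LinearMap.injective_iff_surjective.mp hinj) M
  refine ⟨V, ?_⟩
  have hV' : V - opL Pr (Gam A B K) V = M := hV
  rw [← hV']; abel

lemma opL_transpose (Γ V : Fin N → Matrix (Fin d) (Fin d) ℝ) :
    opL Pr Γ (fun i => (V i)ᵀ) = fun i => (opL Pr Γ V i)ᵀ := by
  ext1 i
  simp [opL, opE, Matrix.transpose_sum, Matrix.mul_assoc]

variable {Q : Fin N → Matrix (Fin d) (Fin d) ℝ} {R : Fin N → Matrix (Fin k) (Fin k) ℝ}

lemma PK_spec (h : MSS Pr A B K) : IsLyap Pr A B Q R K (PK Pr A B Q R K) := by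
  obtain ⟨V, hV⟩ := lyap_exists h (fun i => Q i + (K i)ᵀ * R i * K i)
  have hex : ∃ P, IsLyap Pr A B Q R K P := ⟨V, fun i => congrFun hV i⟩
  unfold PK
  rw [dif_pos hex]
  exact hex.choose_spec

lemma PK_eq (h : MSS Pr A B K) : PK Pr A B Q R K =
    (fun i => Q i + (K i)ᵀ * R i * K i) + opL Pr (Gam A B K) (PK Pr A B Q R K) :=
  funext fun i => PK_spec h i

lemma PK_quad (h : MSS Pr A B K) (i : Fin N) (x : Fin d → ℝ) :
    x ⬝ᵥ PK Pr A B Q R K i *ᵥ x = x ⬝ᵥ Q i *ᵥ x + (K i *ᵥ x) ⬝ᵥ R i *ᵥ (K i *ᵥ x)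
      + (Gam A B K i *ᵥ x) ⬝ᵥ opE Pr (PK Pr A B Q R K) i *ᵥ (Gam A B K i *ᵥ x) := by
  conv_lhs => rw [PK_eq h]
  rw [Pi.add_apply, Matrix.add_mulVec, dotProduct_add, opL_dot, Matrix.add_mulVec, dotProduct_add,
    ← Matrix.mulVec_mulVec, ← Matrix.mulVec_mulVec, Matrix.dotProduct_mulVec x (K i)ᵀ,
    Matrix.vecMul_transpose]

lemma PK_symm (hQ : ∀ i, (Q i).PosDef) (hR : ∀ i, (R i).PosDef) (h : MSS Pr A B K) (i : Fin N) :
    (PK Pr A B Q R K i)ᵀ = PK Pr A B Q R K i := by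
  have hq : ∀ i, (Q i)ᵀ = Q i := fun i => by simpa using (hQ i).1.eq
  have hr : ∀ i, (R i)ᵀ = R i := fun i => by simpa using (hR i).1.eq
  have e := PK_eq (Q := Q) (R := R) h
  set P := PK Pr A B Q R K with hP
  have e2 : (fun i => (P i)ᵀ) = (fun i => Q i + (K i)ᵀ * R i * K i)
      + opL Pr (Gam A B K) (fun i => (P i)ᵀ) := by
    rw [opL_transpose]
    conv_lhs => rw [e]
    ext1 i
    simp [hq, hr, Matrix.mul_assoc]
  have := lyap_unique h (V := (fun i => (P i)ᵀ) - P) (by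
    rw [opL_sub, eq_sub_of_add_eq' e2.symm, eq_sub_of_add_eq' e.symm]
    abel)
  have := congrFun this i
  simpa [sub_eq_zero] using this

lemma PK_qnn (hPr : ∀ i j, 0 ≤ Pr i j) (hQ : ∀ i, (Q i).PosDef) (hR : ∀ i, (R i).PosDef)
    (h : MSS Pr A B K) : QNN (PK Pr A B Q R K) := by
  apply qnn_of_lyap hPr h
  intro i x
  have := PK_quad (Q := Q) (R := R) h i x
  rw [Pi.sub_apply, Matrix.sub_mulVec, dotProduct_sub, opL_dot, this]
  have h1 := (hQ i).posSemidef.dotProduct_mulVec_nonneg x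
  have h2 := (hR i).posSemidef.dotProduct_mulVec_nonneg (K i *ᵥ x)
  simp only [star_trivial] at h1 h2
  linarith

lemma symm_dot {n : ℕ} {M : Matrix (Fin n) (Fin n) ℝ} (hM : Mᵀ = M) (x y : Fin n → ℝ) :
    x ⬝ᵥ M *ᵥ y = y ⬝ᵥ M *ᵥ x := by
  rw [Matrix.dotProduct_mulVec, ← Matrix.mulVec_transpose, hM, dotProduct_comm]

/-- Almost smoothness at the level of quadratic forms. -/
lemma step_quad (hQ : ∀ i, (Q i).PosDef) (hR : ∀ i, (R i).PosDef) (h : MSS Pr A B K)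
    (D : Fin N → Matrix (Fin k) (Fin d) ℝ) (i : Fin N) (x : Fin d → ℝ) :
    x ⬝ᵥ Q i *ᵥ x + ((K + D) i *ᵥ x) ⬝ᵥ R i *ᵥ ((K + D) i *ᵥ x)
      + (Gam A B (K + D) i *ᵥ x) ⬝ᵥ opE Pr (PK Pr A B Q R K) i *ᵥ (Gam A B (K + D) i *ᵥ x)
    = x ⬝ᵥ PK Pr A B Q R K i *ᵥ x
      + 2 * ((D i *ᵥ x) ⬝ᵥ LK Pr A B Q R K i *ᵥ x)
      + ((D i *ᵥ x) ⬝ᵥ R i *ᵥ (D i *ᵥ x)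
        + (B i *ᵥ (D i *ᵥ x)) ⬝ᵥ opE Pr (PK Pr A B Q R K) i *ᵥ (B i *ᵥ (D i *ᵥ x))) := by
  have hr : (R i)ᵀ = R i := by simpa using (hR i).1.eq
  have he : (opE Pr (PK Pr A B Q R K) i)ᵀ = opE Pr (PK Pr A B Q R K) i := by
    simp [opE, Matrix.transpose_sum, PK_symm hQ hR h]
  rw [PK_quad h]
  set E := opE Pr (PK Pr A B Q R K) i with hE
  have hG : Gam A B (K + D) i *ᵥ x = Gam A B K i *ᵥ x - B i *ᵥ (D i *ᵥ x) := by
    simp [Gam, Matrix.mul_add, Matrix.sub_mulVec, Matrix.add_mulVec, sub_sub]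
  have hL : (D i *ᵥ x) ⬝ᵥ LK Pr A B Q R K i *ᵥ x = (D i *ᵥ x) ⬝ᵥ R i *ᵥ (K i *ᵥ x)
      - (B i *ᵥ (D i *ᵥ x)) ⬝ᵥ E *ᵥ (Gam A B K i *ᵥ x) := by
    have e1 : LK Pr A B Q R K i = R i * K i - (B i)ᵀ * (E * Gam A B K i) := by
      simp only [LK, Gam, ← hE, Matrix.add_mul, Matrix.mul_sub, Matrix.mul_assoc]
      abel
    rw [e1, Matrix.sub_mulVec, dotProduct_sub, ← Matrix.mulVec_mulVec,
      ← Matrix.mulVec_mulVec x (B i)ᵀ,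
      Matrix.dotProduct_mulVec (D i *ᵥ x) (B i)ᵀ, Matrix.vecMul_transpose,
      ← Matrix.mulVec_mulVec x E]
  rw [hG, hL, Pi.add_apply, Matrix.add_mulVec]
  set u := K i *ᵥ x
  set e := D i *ᵥ x
  set g := Gam A B K i *ᵥ x
  set b := B i *ᵥ e
  simp only [Matrix.mulVec_add, Matrix.mulVec_sub, dotProduct_add, dotProduct_sub,
    add_dotProduct, sub_dotProduct]
  rw [symm_dot hr u e, symm_dot he g b]
  ring

/-- Lyapunov criterion for mean-square stability. -/
lemma mss_of_lyap (hd : 0 < d) (hN : 0 < N) (hPr : ∀ i j, 0 ≤ Pr i j)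
    (hQ : ∀ i, (Q i).PosDef) {P : Fin N → Matrix (Fin d) (Fin d) ℝ} (hP : QNN P)
    (hW : ∀ i x, x ⬝ᵥ Q i *ᵥ x + x ⬝ᵥ opL Pr (Gam A B K) P i *ᵥ x ≤ x ⬝ᵥ P i *ᵥ x) :
    MSS Pr A B K := by
  have hq := lamMin_pos hd hN hQ
  set q := lamMin Q
  set p := (∑ j, (P j).trace) + q with hp
  have htr : ∀ j, 0 ≤ (P j).trace := fun j => trace_nonneg' (hP j)
  have hsum : 0 ≤ ∑ j, (P j).trace := Finset.sum_nonneg fun j _ => htr j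
  have hp0 : 0 < p := by linarith
  have hPup : ∀ i x, x ⬝ᵥ P i *ᵥ x ≤ p * (x ⬝ᵥ x) := by
    intro i x
    refine (quad_le_trace (hP i) x).trans (mul_le_mul_of_nonneg_right ?_ (dot_self_nonneg x))
    have := Finset.single_le_sum (f := fun j => (P j).trace) (fun j _ => htr j) (Finset.mem_univ i)
    linarith
  have hPlo : ∀ i x, q * (x ⬝ᵥ x) ≤ x ⬝ᵥ P i *ᵥ x := by
    intro i x
    have h1 := lamMin_dot hQ i x
    have h2 := opL_qnn hPr (Gam A B K) hP i x
    linarith [hW i x]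
  set γ := 1 - q / p with hγ
  have hγ1 : γ < 1 := by have : 0 < q / p := by positivity
                         linarith
  have hγ0 : 0 ≤ γ := by
    have : q / p ≤ 1 := by rw [div_le_one hp0]; linarith
    linarith
  have hcon : ∀ i x, x ⬝ᵥ opL Pr (Gam A B K) P i *ᵥ x ≤ γ * (x ⬝ᵥ P i *ᵥ x) := by
    intro i x
    have h1 := lamMin_dot hQ i x
    have h2 : q / p * (x ⬝ᵥ P i *ᵥ x) ≤ q * (x ⬝ᵥ x) := by
      rw [div_mul_eq_mul_div, div_le_iff₀ hp0]
      nlinarith [hPup i x]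
    have := hW i x
    rw [hγ, sub_mul, one_mul]
    linarith
  apply mss_of_tendsto hd hN
  intro V i a b
  set c := maxNorm V / q
  have hc : 0 ≤ c := div_nonneg (maxNorm_nonneg V) hq.le
  have key : ∀ t : ℕ, ∀ i x y, |x ⬝ᵥ (opL Pr (Gam A B K))^[t] V i *ᵥ y| ≤
      c * γ ^ t * (x ⬝ᵥ P i *ᵥ x + y ⬝ᵥ P i *ᵥ y) := by
    intro t
    induction t with
    | zero =>
      intro i x y
      have h1 := maxNorm_bilin V i x y
      have hx := hPlo i x
      have hy := hPlo i y
      have ex := euclid_norm_sq (WithLp.toLp 2 x)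
      have ey := euclid_norm_sq (WithLp.toLp 2 y)
      simp only at ex ey
      have h2 : ‖WithLp.toLp 2 x‖ * ‖WithLp.toLp 2 y‖ ≤
          (x ⬝ᵥ P i *ᵥ x + y ⬝ᵥ P i *ᵥ y) / q := by
        rw [le_div_iff₀ hq]
        have h3 : ‖WithLp.toLp 2 x‖ * ‖WithLp.toLp 2 y‖ ≤ x ⬝ᵥ x + y ⬝ᵥ y := by
          rw [← ex, ← ey]
          nlinarith [sq_nonneg (‖WithLp.toLp 2 x‖ - ‖WithLp.toLp 2 y‖),
            sq_nonneg (‖WithLp.toLp 2 x‖), sq_nonneg ‖WithLp.toLp 2 y‖]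
        nlinarith
      have h3 := h1.trans (mul_le_mul_of_nonneg_left h2 (maxNorm_nonneg V))
      simp only [Function.iterate_zero, id_eq, pow_zero, mul_one]
      refine h3.trans_eq ?_
      simp only [c]; ring
    | succ t ih =>
      intro i x y
      rw [Function.iterate_succ_apply', opL_dot, opE_dot]
      calc |∑ j, Pr i j * ((Gam A B K i *ᵥ x) ⬝ᵥ
              (opL Pr (Gam A B K))^[t] V j *ᵥ (Gam A B K i *ᵥ y))|
          ≤ ∑ j, Pr i j * (c * γ ^ t * ((Gam A B K i *ᵥ x) ⬝ᵥ P j *ᵥ (Gam A B K i *ᵥ x)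
              + (Gam A B K i *ᵥ y) ⬝ᵥ P j *ᵥ (Gam A B K i *ᵥ y))) := by
            refine (Finset.abs_sum_le_sum_abs _ _).trans (Finset.sum_le_sum fun j _ => ?_)
            rw [abs_mul, abs_of_nonneg (hPr i j)]
            exact mul_le_mul_of_nonneg_left (ih j _ _) (hPr i j)
        _ = c * γ ^ t * (x ⬝ᵥ opL Pr (Gam A B K) P i *ᵥ x
              + y ⬝ᵥ opL Pr (Gam A B K) P i *ᵥ y) := by
            rw [opL_dot, opL_dot, opE_dot, opE_dot, ← Finset.sum_add_distrib, Finset.mul_sum]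
            refine Finset.sum_congr rfl fun j _ => ?_
            ring
        _ ≤ c * γ ^ t * (γ * (x ⬝ᵥ P i *ᵥ x) + γ * (y ⬝ᵥ P i *ᵥ y)) := by
            have := hcon i x
            have := hcon i y
            gcongr
        _ = _ := by ring
  have key2 := fun t => key t i (Pi.single a 1) (Pi.single b 1)
  simp only [Matrix.mulVec_single_one, single_one_dotProduct, Matrix.col_apply] at key2
  refine squeeze_zero_norm (a := fun t => c * γ ^ t * (P i a a + P i b b)) key2 ?_
  have := ((tendsto_pow_atTop_nhds_zero_of_lt_one hγ0 hγ1).const_mul c).mul_const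
    (P i a a + P i b b)
  simpa using this

end Lyap

section Main

variable {d k N : ℕ}

lemma trace_duality (Pr : Matrix (Fin N) (Fin N) ℝ) (Γ V W : Fin N → Matrix (Fin d) (Fin d) ℝ) :
    ∑ j, (V j * opT Pr Γ W j).trace = ∑ i, (opL Pr Γ V i * W i).trace := by
  have h1 : ∀ j, (V j * opT Pr Γ W j).trace
      = ∑ i, Pr i j * (V j * (Γ i * W i * (Γ i)ᵀ)).trace := by
    intro j
    simp [opT, Matrix.mul_sum, Matrix.trace_sum]
  have h2 : ∀ i, (opL Pr Γ V i * W i).trace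
      = ∑ j, Pr i j * (V j * (Γ i * W i * (Γ i)ᵀ)).trace := by
    intro i
    have e : ∀ j, (V j * (Γ i * W i * (Γ i)ᵀ)).trace = ((Γ i)ᵀ * V j * Γ i * W i).trace := by
      intro j
      rw [← Matrix.mul_assoc, Matrix.trace_mul_comm]
      simp only [Matrix.mul_assoc]
    simp only [e]
    simp [opL, opE, Matrix.mul_sum, Matrix.sum_mul, Matrix.trace_sum]
  simp only [h1, h2]
  exact Finset.sum_comm

lemma trace_duality_iter (Pr : Matrix (Fin N) (Fin N) ℝ)
    (Γ V W : Fin N → Matrix (Fin d) (Fin d) ℝ) (t : ℕ) :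
    ∑ j, (V j * (opT Pr Γ)^[t] W j).trace = ∑ i, ((opL Pr Γ)^[t] V i * W i).trace := by
  induction t generalizing V with
  | zero => simp
  | succ t ih =>
    rw [Function.iterate_succ_apply', trace_duality, ih, Function.iterate_succ_apply]

variable {Pr : Matrix (Fin N) (Fin N) ℝ}
    {A : Fin N → Matrix (Fin d) (Fin d) ℝ} {B : Fin N → Matrix (Fin d) (Fin k) ℝ}
    {K : Fin N → Matrix (Fin k) (Fin d) ℝ}

lemma opT_summable (h : MSS Pr A B K) (W : Fin N → Matrix (Fin d) (Fin d) ℝ) :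
    Summable fun t : ℕ => (opT Pr (Gam A B K))^[t] W := by
  refine Pi.summable.mpr fun i => ?_
  refine Pi.summable.mpr fun a => ?_
  refine Pi.summable.mpr fun b => ?_
  let V : Fin N → Matrix (Fin d) (Fin d) ℝ := Pi.single i (Matrix.single b a 1)
  have e : ∀ t : ℕ, (opT Pr (Gam A B K))^[t] W i a b
      = ∑ j, ∑ x, ∑ y, (opL Pr (Gam A B K))^[t] V j x y * W j y x := by
    intro t
    have h1 := trace_duality_iter Pr (Gam A B K) V W t
    have h2 : ∑ j, (V j * (opT Pr (Gam A B K))^[t] W j).trace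
        = (opT Pr (Gam A B K))^[t] W i a b := by
      rw [Finset.sum_eq_single i]
      · simp [V, Matrix.trace_single_mul]
      · intro j _ hj
        simp [V, hj]
      · simp
    rw [← h2, h1]
    simp [Matrix.trace, Matrix.mul_apply]
  simp only [e]
  exact summable_sum fun j _ => summable_sum fun x _ => summable_sum fun y _ =>
    (mss_summable h V j x y).mul_right _

lemma opT_continuous (Pr : Matrix (Fin N) (Fin N) ℝ) (Γ : Fin N → Matrix (Fin d) (Fin d) ℝ) :
    Continuous (opT Pr Γ) := by
  unfold opT
  refine continuous_pi fun j => continuous_finsetSum _ fun i _ => ?_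
  have h : Continuous fun V : Fin N → Matrix (Fin d) (Fin d) ℝ => Γ i * V i * (Γ i)ᵀ :=
    (continuous_const.matrix_mul (continuous_apply i)).matrix_mul continuous_const
  exact h.const_smul (Pr i j)

lemma opT_add (Pr : Matrix (Fin N) (Fin N) ℝ) (Γ V W : Fin N → Matrix (Fin d) (Fin d) ℝ) :
    opT Pr Γ (V + W) = opT Pr Γ V + opT Pr Γ W := by
  ext1 j
  simp [opT, Finset.sum_add_distrib, Matrix.mul_add, Matrix.add_mul]

lemma opT_zero (Pr : Matrix (Fin N) (Fin N) ℝ) (Γ : Fin N → Matrix (Fin d) (Fin d) ℝ) :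
    opT Pr Γ 0 = 0 := by
  ext1 j
  simp [opT]

lemma XK_eq (h : MSS Pr A B K) (piv : Fin N → ℝ) (Sg : Matrix (Fin d) (Fin d) ℝ) :
    XK Pr piv Sg (Gam A B K) = (fun i => piv i • Sg)
      + opT Pr (Gam A B K) (XK Pr piv Sg (Gam A B K)) := by
  have hs := opT_summable h (fun i => piv i • Sg)
  have h1 : HasSum (fun t : ℕ => (opT Pr (Gam A B K))^[t] (fun i => piv i • Sg))
    (XK Pr piv Sg (Gam A B K)) := hs.hasSum
  let T : (Fin N → Matrix (Fin d) (Fin d) ℝ) →+ (Fin N → Matrix (Fin d) (Fin d) ℝ) :=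
    { toFun := opT Pr (Gam A B K), map_zero' := opT_zero _ _, map_add' := opT_add _ _ }
  have h2 := h1.map T (opT_continuous Pr (Gam A B K))
  have h3 : HasSum (fun t : ℕ => (opT Pr (Gam A B K))^[t + 1] (fun i => piv i • Sg))
      (opT Pr (Gam A B K) (XK Pr piv Sg (Gam A B K))) := by
    simp only [Function.iterate_succ_apply']
    exact h2
  have h4 := (hasSum_nat_add_iff' (f := fun t : ℕ =>
    (opT Pr (Gam A B K))^[t] (fun i => piv i • Sg)) 1).mpr h1
  have h5 := h3.unique h4
  rw [h5]
  simp

/-- The linear cost functional. -/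
def costf (piv : Fin N → ℝ) (Sg : Matrix (Fin d) (Fin d) ℝ)
    (V : Fin N → Matrix (Fin d) (Fin d) ℝ) : ℝ := ∑ i, piv i * (V i * Sg).trace

lemma costf_sub (piv : Fin N → ℝ) (Sg : Matrix (Fin d) (Fin d) ℝ)
    (V W : Fin N → Matrix (Fin d) (Fin d) ℝ) :
    costf piv Sg (V - W) = costf piv Sg V - costf piv Sg W := by
  simp [costf, Matrix.sub_mul, mul_sub]

lemma mu_pos (hd : 0 < d) (hN : 0 < N) {piv : Fin N → ℝ} (hpiv : ∀ i, 0 < piv i)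
    {Sg : Matrix (Fin d) (Fin d) ℝ} (hSg : Sg.PosDef) : 0 < mu piv Sg := by
  have : Nonempty (Fin N) := ⟨⟨0, hN⟩⟩
  obtain ⟨j, hj⟩ := Finite.exists_min piv
  exact mul_pos ((hpiv j).trans_le (le_ciInf hj)) (sigmaMin_pos hd hSg)

lemma costf_ge (hd : 0 < d) {piv : Fin N → ℝ} (hpiv : ∀ i, 0 < piv i)
    {Sg : Matrix (Fin d) (Fin d) ℝ} (hSg : Sg.PosDef)
    {V : Fin N → Matrix (Fin d) (Fin d) ℝ} (hV : QNN V) :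
    mu piv Sg * ∑ i, (V i).trace ≤ costf piv Sg V := by
  rw [costf, Finset.mul_sum]
  refine Finset.sum_le_sum fun i _ => ?_
  have h1 := trace_mul_ge (hV i) hSg
  have h2 := trace_nonneg' (hV i)
  have h3 : (⨅ i, piv i) ≤ piv i := ciInf_le (Set.finite_range _).bddBelow i
  have h4 := (sigmaMin_pos hd hSg).le
  calc mu piv Sg * (V i).trace = (⨅ i, piv i) * (sigmaMin Sg * (V i).trace) := by
        rw [mu]; ring
    _ ≤ piv i * (sigmaMin Sg * (V i).trace) := by gcongr
    _ ≤ _ := mul_le_mul_of_nonneg_left h1 (hpiv i).le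

lemma costf_nonneg (hd : 0 < d) (hN : 0 < N) {piv : Fin N → ℝ} (hpiv : ∀ i, 0 < piv i)
    {Sg : Matrix (Fin d) (Fin d) ℝ} (hSg : Sg.PosDef)
    {V : Fin N → Matrix (Fin d) (Fin d) ℝ} (hV : QNN V) : 0 ≤ costf piv Sg V :=
  (mul_nonneg (mu_pos hd hN hpiv hSg).le
    (Finset.sum_nonneg fun i _ => trace_nonneg' (hV i))).trans (costf_ge hd hpiv hSg hV)

lemma gram_dot {a b : ℕ} (c : ℝ) (L : Matrix (Fin a) (Fin b) ℝ) (x : Fin b → ℝ) :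
    x ⬝ᵥ (c • (Lᵀ * L)) *ᵥ x = c * ((L *ᵥ x) ⬝ᵥ (L *ᵥ x)) := by
  rw [Matrix.smul_mulVec, dotProduct_smul, ← Matrix.mulVec_mulVec, Matrix.dotProduct_mulVec,
    Matrix.vecMul_transpose, smul_eq_mul]

lemma trace_gram_le {a : ℕ} (X : Fin N → Matrix (Fin d) (Fin d) ℝ) (i : Fin N)
    (L : Matrix (Fin a) (Fin d) ℝ) :
    ((Lᵀ * L) * X i).trace ≤ maxNorm X * (Lᵀ * L).trace := by
  have e1 : ((Lᵀ * L) * X i).trace = ∑ j, L j ⬝ᵥ X i *ᵥ L j := by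
    rw [Matrix.mul_assoc, Matrix.trace_mul_comm]
    refine Finset.sum_congr rfl fun j _ => ?_
    rw [Matrix.diag_apply, Matrix.mul_apply, Matrix.dotProduct_mulVec]
    simp [dotProduct, Matrix.mul_apply, Matrix.vecMul]
  have e2 : (Lᵀ * L).trace = ∑ j, L j ⬝ᵥ L j := by
    rw [Matrix.trace_mul_comm]
    refine Finset.sum_congr rfl fun j _ => ?_
    simp [Matrix.mul_apply, dotProduct]
  rw [e1, e2, Finset.mul_sum]
  exact Finset.sum_le_sum fun j _ => maxNorm_quad X i (L j)

variable {Q : Fin N → Matrix (Fin d) (Fin d) ℝ} {R : Fin N → Matrix (Fin k) (Fin k) ℝ}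

lemma descent (hd : 0 < d) (hN : 0 < N)
    (hPr : ∀ i j, 0 ≤ Pr i j) (hPrSum : ∀ i, ∑ j, Pr i j = 1)
    {piv : Fin N → ℝ} (hpiv : ∀ i, 0 < piv i)
    {Sg : Matrix (Fin d) (Fin d) ℝ} (hSg : Sg.PosDef)
    (hQ : ∀ i, (Q i).PosDef) (hR : ∀ i, (R i).PosDef) (hK : MSS Pr A B K)
    {C0 η : ℝ} (hC : cost Pr A B Q R piv Sg K ≤ C0) (hη0 : 0 < η)
    (hη : η * (maxNorm R + maxNorm B ^ 2 * C0 / mu piv Sg) ≤ 1 / 2) :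
    MSS Pr A B (K - (2 * η) • LK Pr A B Q R K) ∧
      cost Pr A B Q R piv Sg (K - (2 * η) • LK Pr A B Q R K) ≤ cost Pr A B Q R piv Sg K
        - 2 * η * mu piv Sg * ∑ i, ((LK Pr A B Q R K i)ᵀ * LK Pr A B Q R K i).trace := by
  have hmu := mu_pos hd hN hpiv hSg
  have hPq : QNN (PK Pr A B Q R K) := PK_qnn hPr hQ hR hK
  set P := PK Pr A B Q R K with hP
  set L := LK Pr A B Q R K with hL
  set m := mu piv Sg
  set h := maxNorm R + maxNorm B ^ 2 * C0 / m with hh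
  have htr : ∀ j, (P j).trace ≤ C0 / m := by
    intro j
    rw [le_div_iff₀ hmu, mul_comm]
    refine le_trans ?_ ((costf_ge hd hpiv hSg hPq).trans hC)
    refine mul_le_mul_of_nonneg_left ?_ hmu.le
    exact Finset.single_le_sum (f := fun j => (P j).trace)
      (fun j _ => trace_nonneg' (hPq j)) (Finset.mem_univ j)
  have hE : ∀ i y, y ⬝ᵥ opE Pr P i *ᵥ y ≤ C0 / m * (y ⬝ᵥ y) := by
    intro i y
    rw [opE_dot]
    calc ∑ j, Pr i j * (y ⬝ᵥ P j *ᵥ y) ≤ ∑ j, Pr i j * (C0 / m * (y ⬝ᵥ y)) :=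
          Finset.sum_le_sum fun j _ => mul_le_mul_of_nonneg_left
            ((quad_le_trace (hPq j) y).trans
              (mul_le_mul_of_nonneg_right (htr j) (dot_self_nonneg y))) (hPr i j)
      _ = _ := by rw [← Finset.sum_mul, hPrSum, one_mul]
  have hC0 : 0 ≤ C0 / m := by
    have i0 : Fin N := ⟨0, hN⟩
    exact (trace_nonneg' (hPq i0)).trans (htr i0)
  have hH : ∀ i e, e ⬝ᵥ R i *ᵥ e + (B i *ᵥ e) ⬝ᵥ opE Pr P i *ᵥ (B i *ᵥ e) ≤ h * (e ⬝ᵥ e) := by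
    intro i e
    have h1 := maxNorm_quad R i e
    have h2 := hE i (B i *ᵥ e)
    have h3 := mul_le_mul_of_nonneg_left (maxNorm_mulVec B i e) hC0
    have h4 : h * (e ⬝ᵥ e) = maxNorm R * (e ⬝ᵥ e) + C0 / m * (maxNorm B ^ 2 * (e ⬝ᵥ e)) := by
      rw [hh]; ring
    linarith
  set K' := K - (2 * η) • L with hK'
  have hKD : K' = K + (-(2 * η)) • L := by rw [hK', neg_smul, sub_eq_add_neg]
  have key : ∀ i x, x ⬝ᵥ Q i *ᵥ x + (K' i *ᵥ x) ⬝ᵥ R i *ᵥ (K' i *ᵥ x)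
      + x ⬝ᵥ opL Pr (Gam A B K') P i *ᵥ x + 2 * η * ((L i *ᵥ x) ⬝ᵥ (L i *ᵥ x))
      ≤ x ⬝ᵥ P i *ᵥ x := by
    intro i x
    have h1 := step_quad hQ hR hK ((-(2 * η)) • L) i x
    rw [← hKD, ← hP, ← hL] at h1
    have h2 := hH i (((-(2 * η)) • L) i *ᵥ x)
    have e1 : ((-(2 * η)) • L) i *ᵥ x = (-(2 * η)) • (L i *ᵥ x) := by
      rw [Pi.smul_apply, Matrix.smul_mulVec]
    rw [opL_dot, h1]
    generalize hT : (((-(2 * η)) • L) i *ᵥ x ⬝ᵥ R i *ᵥ ((-(2 * η)) • L) i *ᵥ x +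
      (B i *ᵥ ((-(2 * η)) • L) i *ᵥ x) ⬝ᵥ opE Pr P i *ᵥ (B i *ᵥ ((-(2 * η)) • L) i *ᵥ x)) = T at h2 ⊢
    rw [e1] at h2 ⊢
    simp only [smul_dotProduct, dotProduct_smul, smul_eq_mul] at h2 ⊢
    have hl := dot_self_nonneg (L i *ᵥ x)
    have h3 : η * h * (η * ((L i *ᵥ x) ⬝ᵥ (L i *ᵥ x))) ≤
        1 / 2 * (η * ((L i *ᵥ x) ⬝ᵥ (L i *ᵥ x))) :=
      mul_le_mul_of_nonneg_right hη (mul_nonneg hη0.le hl)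
    nlinarith
  have hRn : ∀ i y, 0 ≤ y ⬝ᵥ R i *ᵥ y := fun i y => by
    simpa using (hR i).posSemidef.dotProduct_mulVec_nonneg y
  have hln : ∀ i x, 0 ≤ 2 * η * ((L i *ᵥ x) ⬝ᵥ (L i *ᵥ x)) := fun i x =>
    mul_nonneg (by positivity) (dot_self_nonneg _)
  have hmss : MSS Pr A B K' := by
    refine mss_of_lyap hd hN hPr hQ hPq fun i x => ?_
    linarith [key i x, hRn i (K' i *ᵥ x), hln i x]
  refine ⟨hmss, ?_⟩
  set P' := PK Pr A B Q R K' with hP'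
  have hdiff : ∀ i x, 2 * η * ((L i *ᵥ x) ⬝ᵥ (L i *ᵥ x)) ≤
      x ⬝ᵥ ((P - P') - opL Pr (Gam A B K') (P - P')) i *ᵥ x := by
    intro i x
    have h1 := PK_quad (Q := Q) (R := R) hmss i x
    rw [← hP', ← opL_dot] at h1
    rw [opL_sub]
    simp only [Pi.sub_apply, Matrix.sub_mulVec, dotProduct_sub]
    linarith [key i x]
  have hV : QNN (P - P') := qnn_of_lyap hPr hmss fun i x => (hln i x).trans (hdiff i x)
  have hVS : QNN ((P - P') - fun i => (2 * η) • ((L i)ᵀ * L i)) := by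
    intro i x
    have h1 := opL_qnn hPr (Gam A B K') hV i x
    have h2 := hdiff i x
    rw [Pi.sub_apply, Matrix.sub_mulVec, dotProduct_sub] at h2 ⊢
    rw [gram_dot]
    linarith
  have hS : QNN (fun i => (2 * η) • ((L i)ᵀ * L i)) := by
    intro i x
    rw [gram_dot]; exact hln i x
  have c1 := costf_nonneg hd hN hpiv hSg hVS
  have c2 := costf_ge hd hpiv hSg hS
  rw [costf_sub, costf_sub] at c1
  have c3 : ∑ i, ((2 * η) • ((L i)ᵀ * L i)).trace = 2 * η * ∑ i, ((L i)ᵀ * L i).trace := by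
    simp [Finset.mul_sum]
  rw [c3] at c2
  change costf piv Sg P' ≤ costf piv Sg P - _
  have c4 : 2 * η * m * ∑ i, ((L i)ᵀ * L i).trace = m * (2 * η * ∑ i, ((L i)ᵀ * L i).trace) := by
    ring
  rw [c4]
  linarith

lemma gradient_domination (hd : 0 < d) (hk : 0 < k) (hN : 0 < N)
    (hPr : ∀ i j, 0 ≤ Pr i j)
    {piv : Fin N → ℝ} (hpiv : ∀ i, 0 < piv i)
    {Sg : Matrix (Fin d) (Fin d) ℝ} (hSg : Sg.PosDef)
    (hQ : ∀ i, (Q i).PosDef) (hR : ∀ i, (R i).PosDef) (hK : MSS Pr A B K)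
    {Ks : Fin N → Matrix (Fin k) (Fin d) ℝ} (hKs : MSS Pr A B Ks) :
    lamMin R * (cost Pr A B Q R piv Sg K - cost Pr A B Q R piv Sg Ks) ≤
      maxNorm (XK Pr piv Sg (Gam A B Ks)) *
        ∑ i, ((LK Pr A B Q R K i)ᵀ * LK Pr A B Q R K i).trace := by
  have hr := lamMin_pos hk hN hR
  have hrd := lamMin_dot hR
  set r := lamMin R
  have hPq : QNN (PK Pr A B Q R K) := PK_qnn hPr hQ hR hK
  set P := PK Pr A B Q R K with hP
  set L := LK Pr A B Q R K with hL
  set Ps := PK Pr A B Q R Ks with hPs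
  set X := XK Pr piv Sg (Gam A B Ks) with hX
  have hdiff : ∀ i x, x ⬝ᵥ ((P - Ps) - opL Pr (Gam A B Ks) (P - Ps)) i *ᵥ x ≤
      r⁻¹ * ((L i *ᵥ x) ⬝ᵥ (L i *ᵥ x)) := by
    intro i x
    have h0 := step_quad hQ hR hK (Ks - K) i x
    rw [add_sub_cancel, ← hP, ← hL, ← opL_dot] at h0
    have h1 := PK_quad (Q := Q) (R := R) hKs i x
    rw [← hPs, ← opL_dot] at h1
    rw [opL_sub]
    simp only [Pi.sub_apply, Matrix.sub_mulVec, dotProduct_sub] at h0 ⊢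
    rw [← Matrix.sub_mulVec] at h0
    have h2 := opE_qnn hPr hPq i (B i *ᵥ ((Ks i - K i) *ᵥ x))
    have h3 := hrd i ((Ks i - K i) *ᵥ x)
    set e := (Ks i - K i) *ᵥ x
    set l := L i *ᵥ x
    have h4 := dot_self_nonneg (r • e + l)
    simp only [add_dotProduct, dotProduct_add, smul_dotProduct, dotProduct_smul,
      smul_eq_mul, dotProduct_comm l e] at h4
    have h5 : -(2 * (e ⬝ᵥ l)) - r * (e ⬝ᵥ e) ≤ r⁻¹ * (l ⬝ᵥ l) := by
      rw [inv_mul_eq_div, le_div_iff₀ hr]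
      nlinarith
    linarith
  obtain ⟨Y, hY⟩ := lyap_exists hKs (fun i => r⁻¹ • ((L i)ᵀ * L i))
  have hYV : QNN (Y - (P - Ps)) := by
    apply qnn_of_lyap hPr hKs
    intro i x
    have e : (Y - (P - Ps)) - opL Pr (Gam A B Ks) (Y - (P - Ps)) =
        (fun i => r⁻¹ • ((L i)ᵀ * L i)) - ((P - Ps) - opL Pr (Gam A B Ks) (P - Ps)) := by
      rw [opL_sub, eq_sub_of_add_eq hY.symm]
      abel
    rw [e, Pi.sub_apply _ _ i, Matrix.sub_mulVec, dotProduct_sub, gram_dot]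
    linarith [hdiff i x]
  have c1 := costf_nonneg hd hN hpiv hSg hYV
  rw [costf_sub, costf_sub] at c1
  have c2 : costf piv Sg Y = ∑ i, ((r⁻¹ • ((L i)ᵀ * L i)) * X i).trace := by
    have e1 : ∀ i, piv i • Sg = X i - opT Pr (Gam A B Ks) X i := fun i => by
      have := congrFun (XK_eq hKs piv Sg) i
      rw [← hX] at this
      exact eq_sub_of_add_eq this.symm
    have e2 : costf piv Sg Y = ∑ i, (Y i * (piv i • Sg)).trace := by simp [costf]
    rw [e2]
    simp only [e1, Matrix.mul_sub, Matrix.trace_sub, Finset.sum_sub_distrib]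
    rw [trace_duality, ← Finset.sum_sub_distrib]
    refine Finset.sum_congr rfl fun i _ => ?_
    rw [← Matrix.trace_sub, ← Matrix.sub_mul]
    congr 2
    exact (eq_sub_of_add_eq (congrFun hY i).symm).symm
  have c3 : r * costf piv Sg Y ≤ maxNorm X * ∑ i, ((L i)ᵀ * L i).trace := by
    rw [c2, Finset.mul_sum, Finset.mul_sum]
    refine Finset.sum_le_sum fun i _ => ?_
    rw [Matrix.smul_mul, Matrix.trace_smul, smul_eq_mul, mul_inv_cancel_left₀ hr.ne']
    exact trace_gram_le X i (L i)
  refine le_trans (mul_le_mul_of_nonneg_left ?_ hr.le) c3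
  change costf piv Sg P - costf piv Sg Ps ≤ _
  linarith

end Main

/-- global linear convergence of the natural policy gradient method. -/
theorem natural_pg_global_linear_convergence
    (d k N : ℕ) (hd : 0 < d) (hk : 0 < k) (hN : 0 < N)
    (A : Fin N → Matrix (Fin d) (Fin d) ℝ) (B : Fin N → Matrix (Fin d) (Fin k) ℝ)
    (Pr : Matrix (Fin N) (Fin N) ℝ)
    (hPr : ∀ i j, 0 ≤ Pr i j) (hPrSum : ∀ i, ∑ j, Pr i j = 1)
    (piv : Fin N → ℝ) (hpiv : ∀ i, 0 < piv i) (hpivSum : ∑ i, piv i = 1)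
    (Sg : Matrix (Fin d) (Fin d) ℝ) (hSg : Sg.PosDef)
    (Q : Fin N → Matrix (Fin d) (Fin d) ℝ) (hQ : ∀ i, (Q i).PosDef)
    (R : Fin N → Matrix (Fin k) (Fin k) ℝ) (hR : ∀ i, (R i).PosDef)
    (K0 : Fin N → Matrix (Fin k) (Fin d) ℝ) (hK0 : MSS Pr A B K0)
    (η : ℝ) (hη0 : 0 < η)
    (hη : η ≤ 1 / 2 * (maxNorm R + maxNorm B ^ 2 * cost Pr A B Q R piv Sg K0 / mu piv Sg)⁻¹)
    (Ks : Fin N → Matrix (Fin k) (Fin d) ℝ) (hKs : MSS Pr A B Ks)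
    (hopt : ∀ K' : Fin N → Matrix (Fin k) (Fin d) ℝ, MSS Pr A B K' → cost Pr A B Q R piv Sg Ks ≤ cost Pr A B Q R piv Sg K')
    (Kseq : ℕ → Fin N → Matrix (Fin k) (Fin d) ℝ) (hinit : Kseq 0 = K0)
    (hstep : ∀ n, Kseq (n + 1) = Kseq n - (2 * η) • LK Pr A B Q R (Kseq n)) :
    ∀ n, MSS Pr A B (Kseq n) ∧
      cost Pr A B Q R piv Sg (Kseq n) - cost Pr A B Q R piv Sg Ks
        ≤ (1 - 2 * mu piv Sg * lamMin R * η / maxNorm (XK Pr piv Sg (Gam A B Ks))) ^ n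
            * (cost Pr A B Q R piv Sg K0 - cost Pr A B Q R piv Sg Ks) := by
  have hmu := mu_pos hd hN hpiv hSg
  set C := cost Pr A B Q R piv Sg with hCdef
  set h := maxNorm R + maxNorm B ^ 2 * C K0 / mu piv Sg with hh
  have hhpos : 0 < h := by
    by_contra hc
    have : h⁻¹ ≤ 0 := inv_nonpos.mpr (not_lt.mp hc)
    linarith
  have hη' : η * h ≤ 1 / 2 := by
    have := mul_le_mul_of_nonneg_right hη hhpos.le
    rwa [mul_assoc, inv_mul_cancel₀ hhpos.ne', mul_one] at this
  set Xn := maxNorm (XK Pr piv Sg (Gam A B Ks)) with hXn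
  set ρ := 1 - 2 * mu piv Sg * lamMin R * η / Xn with hρ
  have hXn0 : 0 ≤ Xn := maxNorm_nonneg _
  have hstep1 : ∀ K, MSS Pr A B K → C K ≤ C K0 →
      MSS Pr A B (K - (2 * η) • LK Pr A B Q R K) ∧
      C (K - (2 * η) • LK Pr A B Q R K) ≤ C K ∧
      C (K - (2 * η) • LK Pr A B Q R K) - C Ks ≤ ρ * (C K - C Ks) := by
    intro K hK hCK
    obtain ⟨h1, h2⟩ := descent hd hN hPr hPrSum hpiv hSg hQ hR hK hCK hη0 hη'
    have h3 := gradient_domination hd hk hN hPr hpiv hSg hQ hR hK hKs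
    rw [← hCdef] at h2 h3
    rw [← hXn] at h3
    have hs : 0 ≤ ∑ i, ((LK Pr A B Q R K i)ᵀ * LK Pr A B Q R K i).trace := by
      refine Finset.sum_nonneg fun i _ => trace_nonneg' fun x => ?_
      have := gram_dot 1 (LK Pr A B Q R K i) x
      rw [one_smul, one_mul] at this
      rw [this]
      exact dot_self_nonneg _
    set s := ∑ i, ((LK Pr A B Q R K i)ᵀ * LK Pr A B Q R K i).trace
    have hms : 0 ≤ 2 * η * mu piv Sg := by positivity
    refine ⟨h1, by linarith [mul_nonneg hms hs], ?_⟩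
    have h4 : 2 * mu piv Sg * lamMin R * η / Xn * (C K - C Ks) ≤ 2 * η * mu piv Sg * s := by
      rcases hXn0.eq_or_lt with h0 | h0
      · rw [← h0]
        simpa using mul_nonneg hms hs
      · rw [div_mul_eq_mul_div, div_le_iff₀ h0]
        have := mul_le_mul_of_nonneg_left h3 hms
        linarith
    rw [hρ, sub_mul, one_mul]
    linarith
  have hinv : ∀ n, MSS Pr A B (Kseq n) ∧ C (Kseq n) ≤ C K0 := by
    intro n
    induction n with
    | zero => rw [hinit]; exact ⟨hK0, le_rfl⟩
    | succ n ih =>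
      obtain ⟨h1, h2, -⟩ := hstep1 _ ih.1 ih.2
      rw [hstep]
      exact ⟨h1, h2.trans ih.2⟩
  intro n
  refine ⟨(hinv n).1, ?_⟩
  rcases (hopt K0 hK0).eq_or_lt with h0 | h0
  · rw [h0, sub_self, mul_zero]
    linarith [(hinv n).2]
  · have hρ0 : 0 ≤ ρ := by
      obtain ⟨h1, -, h3⟩ := hstep1 K0 hK0 le_rfl
      have h4 := hopt _ h1
      by_contra hc
      have := mul_neg_of_neg_of_pos (not_le.mp hc) (sub_pos.mpr h0)
      linarith
    induction n with
    | zero => rw [hinit]; simp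
    | succ n ih =>
      obtain ⟨-, -, h3⟩ := hstep1 _ (hinv n).1 (hinv n).2
      rw [hstep]
      refine h3.trans ?_
      rw [pow_succ', mul_assoc]
      exact mul_le_mul_of_nonneg_left ih hρ0

end MJLS
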